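/- arXiv:math/9906052 — 5 statements merged into one kernel-verified Lean document; each statement's English description precedes it below -/
import Mathlib

section
/- Let α < 1, β > 0 with α + β > 1, let δ = β/(α+2β-1) and H = 1/2 + (α+β-1)/(2β), and let a : [0,∞) → [0,∞) be continuous, compactly supported and nonnegative. Define r(s) = ∫₀^∞ e^{-k^{2β} s} a(k) k^{1-2α} dk for s ≥ 0. Then for every t > 0, lim_{ε → 0⁺} ε² ∫₀^{t/ε^{2δ}} ∫₀^{s} r(s') ds' ds = a(0) · t^{2H} · ∫₀^∞ (e^{-k^{2β}} − 1 + k^{2β}) k^{1−2α−4β} dk. -/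
open MeasureTheory Real Filter

lemma aux_swap (f : ℝ → ℝ → ℝ) (b : ℝ → ℝ) (C T : ℝ) (hT : 0 ≤ T)
    (hf : Measurable (Function.uncurry f))
    (hb : IntegrableOn b (Set.Ioi 0))
    (hC : ∀ s, 0 < s → s ≤ T → ∀ k, 0 < k → |f s k| ≤ C) :
    ∫ s in (0:ℝ)..T, ∫ k in Set.Ioi (0:ℝ), f s k * b k
      = ∫ k in Set.Ioi (0:ℝ), (∫ s in (0:ℝ)..T, f s k) * b k := by
  rw [intervalIntegral.integral_of_le hT]
  rw [integral_integral_swap]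
  · refine integral_congr_ae (Eventually.of_forall fun k => ?_)
    simp only
    rw [intervalIntegral.integral_of_le hT, integral_mul_const]
  · have h1 : Integrable (fun _ : ℝ => C) (volume.restrict (Set.Ioc 0 T)) :=
      integrable_const C
    have h2 := h1.mul_prod hb
    refine h2.mono ?_ ?_
    · refine AEStronglyMeasurable.mul hf.aestronglyMeasurable ?_
      exact hb.aestronglyMeasurable.comp_snd
    · rw [Measure.prod_restrict]
      refine (ae_restrict_iff' (measurableSet_Ioc.prod measurableSet_Ioi)).2
        (Eventually.of_forall ?_)
      rintro ⟨s, k⟩ ⟨hs, hk⟩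
      have := hC s hs.1 hs.2 k hk
      simp only [Function.uncurry, norm_mul, Real.norm_eq_abs]
      exact mul_le_mul_of_nonneg_right (this.trans (le_abs_self C)) (abs_nonneg _)

lemma aux_int1 (l T : ℝ) (hl : 0 < l) :
    ∫ s in (0:ℝ)..T, Real.exp (-l * s) = (1 - Real.exp (-l * T)) / l := by
  rw [intervalIntegral.integral_eq_sub_of_hasDerivAt
    (f := fun s => -Real.exp (-l * s) / l)]
  · simp; ring
  · intro x _
    have h := (((hasDerivAt_id x).const_mul (-l)).exp.neg).div_const l
    refine HasDerivAt.congr_deriv (f := fun s => -Real.exp (-l * s) / l) h ?_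
    simp only [id]; field_simp
  · apply Continuous.intervalIntegrable; fun_prop

lemma aux_int2 (l T : ℝ) (hl : 0 < l) :
    ∫ s in (0:ℝ)..T, (1 - Real.exp (-l * s)) / l
      = (Real.exp (-l * T) - 1 + l * T) / l ^ 2 := by
  rw [intervalIntegral.integral_eq_sub_of_hasDerivAt
    (f := fun s => (Real.exp (-l * s) + l * s) / l ^ 2)]
  · simp; ring
  · intro x _
    have h := (((hasDerivAt_id x).const_mul (-l)).exp.add
      ((hasDerivAt_id x).const_mul l)).div_const (l ^ 2)
    refine HasDerivAt.congr_deriv (f := fun s => (Real.exp (-l * s) + l * s) / l ^ 2) h ?_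
    simp only [id]; field_simp; ring
  · apply Continuous.intervalIntegrable; fun_prop

lemma aux_b (a : ℝ → ℝ) (p : ℝ) (hp : -1 < p) (ha_cont : Continuous a)
    (ha_supp : HasCompactSupport a) :
    IntegrableOn (fun k => a k * k ^ p) (Set.Ioi (0:ℝ)) := by
  obtain ⟨R, hR⟩ := ha_supp.isCompact.isBounded.subset_closedBall 0
  obtain ⟨C, hC⟩ := ha_supp.exists_bound_of_continuous ha_cont
  have h1 : IntegrableOn (fun k : ℝ => k ^ p) (Set.Ioc 0 (max R 0)) := by
    have := intervalIntegral.intervalIntegrable_rpow' (a := 0) (b := max R 0) hp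
    rwa [intervalIntegrable_iff_integrableOn_Ioc_of_le (le_max_right _ _)] at this
  have h2 : IntegrableOn (fun k => a k * k ^ p) (Set.Ioc 0 (max R 0)) :=
    h1.bdd_mul (c := C) ha_cont.aestronglyMeasurable (Eventually.of_forall hC)
  refine h2.of_forall_sdiff_eq_zero measurableSet_Ioi ?_
  rintro x ⟨hx, hx2⟩
  have hx0 : (0:ℝ) < x := hx
  have : R < x := by
    by_contra hh
    exact hx2 ⟨hx, (not_lt.1 hh).trans (le_max_left _ _)⟩
  have hz : a x = 0 := by
    by_contra hne
    have := hR (subset_tsupport a hne)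
    rw [mem_closedBall_zero_iff, Real.norm_eq_abs, abs_of_pos hx0] at this
    linarith
  simp [hz]

lemma aux_bd0 (x : ℝ) : 0 ≤ Real.exp (-x) - 1 + x := by
  have := Real.add_one_le_exp (-x); linarith

lemma aux_phi (α β : ℝ) (hα : α < 1) (hβ : 0 < β) (hαβ : 1 < α + β) :
    IntegrableOn (fun k : ℝ => (Real.exp (-(k ^ (2*β))) - 1 + k ^ (2*β))
      * k ^ (1 - 2*α - 4*β)) (Set.Ioi (0:ℝ)) := by
  have hm : Measurable (fun k : ℝ => (Real.exp (-(k ^ (2*β))) - 1 + k ^ (2*β))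
      * k ^ (1 - 2*α - 4*β)) := by fun_prop
  rw [← Set.Ioc_union_Ioi_eq_Ioi (zero_le_one' ℝ)]
  refine IntegrableOn.union ?_ ?_
  · have h1 : IntegrableOn (fun k : ℝ => k ^ (1-2*α)) (Set.Ioc 0 1) := by
      have := intervalIntegral.intervalIntegrable_rpow' (a := 0) (b := 1)
        (r := 1 - 2*α) (by linarith)
      rwa [intervalIntegrable_iff_integrableOn_Ioc_of_le zero_le_one] at this
    refine h1.mono' hm.aestronglyMeasurable ?_
    refine (ae_restrict_iff' measurableSet_Ioc).2 (Eventually.of_forall ?_)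
    intro k hk
    have hk0 := hk.1
    have hx0 : 0 < k ^ (2*β) := Real.rpow_pos_of_pos hk0 _
    have hx1 : k ^ (2*β) ≤ 1 := Real.rpow_le_one hk0.le hk.2 (by linarith)
    have hb := Real.abs_exp_sub_one_sub_id_le (x := -(k ^ (2*β)))
      (by rw [abs_neg, abs_of_pos hx0]; exact hx1)
    rw [Real.norm_eq_abs, abs_of_nonneg
      (mul_nonneg (aux_bd0 _) (Real.rpow_nonneg hk0.le _))]
    have e : k ^ (1 - 2*α) = (k ^ (2*β))^2 * k ^ (1 - 2*α - 4*β) := by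
      rw [← Real.rpow_natCast, ← Real.rpow_mul hk0.le, ← Real.rpow_add hk0]
      congr 1; push_cast; ring
    rw [e]
    refine mul_le_mul_of_nonneg_right ?_ (Real.rpow_nonneg hk0.le _)
    have := le_of_abs_le hb
    nlinarith
  · have h1 : IntegrableOn (fun k : ℝ => k ^ (1-2*α-2*β)) (Set.Ioi 1) :=
      integrableOn_Ioi_rpow_of_lt (by linarith) one_pos
    refine h1.mono' hm.aestronglyMeasurable ?_
    refine (ae_restrict_iff' measurableSet_Ioi).2 (Eventually.of_forall ?_)
    intro k hk
    have hk0 : (0:ℝ) < k := lt_trans one_pos hk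
    have hx0 : 0 < k ^ (2*β) := Real.rpow_pos_of_pos hk0 _
    rw [Real.norm_eq_abs, abs_of_nonneg
      (mul_nonneg (aux_bd0 _) (Real.rpow_nonneg hk0.le _))]
    have e : k ^ (1 - 2*α - 2*β) = k ^ (2*β) * k ^ (1 - 2*α - 4*β) := by
      rw [← Real.rpow_add hk0]
      congr 1; ring
    rw [e]
    refine mul_le_mul_of_nonneg_right ?_ (Real.rpow_nonneg hk0.le _)
    have : Real.exp (-(k ^ (2*β))) ≤ 1 := Real.exp_le_one_iff.2 (by linarith)
    linarith

lemma aux_F (α β : ℝ) (hα : α < 1) (hβ : 0 < β)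
    (a : ℝ → ℝ) (ha_cont : Continuous a) (ha_supp : HasCompactSupport a)
    (r : ℝ → ℝ)
    (hr : ∀ s : ℝ, 0 ≤ s →
      r s = ∫ k in Set.Ioi (0:ℝ), Real.exp (-(k ^ (2*β)) * s) * a k * k ^ (1 - 2*α))
    (T : ℝ) (hT : 0 < T) :
    ∫ s in (0:ℝ)..T, ∫ s' in (0:ℝ)..s, r s' =
      ∫ k in Set.Ioi (0:ℝ), (Real.exp (-(k ^ (2*β)) * T) - 1 + k ^ (2*β) * T)
        / (k ^ (2*β)) ^ 2 * (a k * k ^ (1 - 2*α)) := by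
  have hb := aux_b a (1 - 2*α) (by linarith) ha_cont ha_supp
  have e1 : ∀ s, 0 ≤ s → ∫ s' in (0:ℝ)..s, r s' =
      ∫ k in Set.Ioi (0:ℝ), (1 - Real.exp (-(k ^ (2*β)) * s)) / k ^ (2*β)
        * (a k * k ^ (1 - 2*α)) := by
    intro s hs
    have : ∫ s' in (0:ℝ)..s, r s' = ∫ s' in (0:ℝ)..s, ∫ k in Set.Ioi (0:ℝ),
        Real.exp (-(k ^ (2*β)) * s') * (a k * k ^ (1 - 2*α)) := by
      refine intervalIntegral.integral_congr fun x hx => ?_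
      rw [Set.uIcc_of_le hs] at hx
      simp only [hr x hx.1, mul_assoc]
    rw [this, aux_swap (fun s k => Real.exp (-(k ^ (2*β)) * s)) _ 1 s hs
      (by unfold Function.uncurry; fun_prop) hb]
    · refine setIntegral_congr_fun measurableSet_Ioi fun k hk => ?_
      rw [aux_int1 _ _ (Real.rpow_pos_of_pos hk _)]
    · intro s hs _ k hk
      have := Real.rpow_pos_of_pos hk (2*β)
      rw [abs_of_pos (Real.exp_pos _)]
      exact Real.exp_le_one_iff.2 (by nlinarith)
  have : ∫ s in (0:ℝ)..T, ∫ s' in (0:ℝ)..s, r s' = ∫ s in (0:ℝ)..T,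
      ∫ k in Set.Ioi (0:ℝ), (1 - Real.exp (-(k ^ (2*β)) * s)) / k ^ (2*β)
        * (a k * k ^ (1 - 2*α)) := by
    refine intervalIntegral.integral_congr fun x hx => ?_
    rw [Set.uIcc_of_le hT.le] at hx
    exact e1 x hx.1
  rw [this, aux_swap (fun s k => (1 - Real.exp (-(k ^ (2*β)) * s)) / k ^ (2*β)) _ T T hT.le
      (by unfold Function.uncurry; fun_prop) hb]
  · refine setIntegral_congr_fun measurableSet_Ioi fun k hk => ?_
    rw [aux_int2 _ _ (Real.rpow_pos_of_pos hk _)]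
  · intro s hs hsT k hk
    have hl := Real.rpow_pos_of_pos hk (2*β)
    have h1 := Real.add_one_le_exp (-(k ^ (2*β)) * s)
    have h2 : Real.exp (-(k ^ (2*β)) * s) ≤ 1 := Real.exp_le_one_iff.2 (by nlinarith)
    rw [abs_of_nonneg (div_nonneg (by linarith) hl.le), div_le_iff₀ hl]
    nlinarith

lemma aux_G (α β : ℝ) (hβ : 0 < β) (a : ℝ → ℝ) (c T : ℝ) (hc : 0 < c)
    (hcT : c ^ (2*β) = T) :
    ∫ k in Set.Ioi (0:ℝ), (Real.exp (-(k ^ (2*β)) * T) - 1 + k ^ (2*β) * T)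
        / (k ^ (2*β)) ^ 2 * (a k * k ^ (1 - 2*α))
    = c ^ (4*β + 2*α - 2) * ∫ u in Set.Ioi (0:ℝ),
      (Real.exp (-(u ^ (2*β))) - 1 + u ^ (2*β)) * u ^ (1 - 2*α - 4*β) * a (c⁻¹ * u) := by
  have key := integral_comp_mul_left_Ioi (fun u => 
    (Real.exp (-(u ^ (2*β))) - 1 + u ^ (2*β)) * u ^ (1 - 2*α - 4*β) * a (c⁻¹ * u)) 0 hc
  rw [mul_zero, smul_eq_mul] at key
  have e : c ^ (4*β + 2*α - 2) = c ^ (4*β + 2*α - 1) * c⁻¹ := by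
    rw [← Real.rpow_neg_one c, ← Real.rpow_add hc]; congr 1; ring
  rw [e, mul_assoc, ← key, ← integral_const_mul]
  refine setIntegral_congr_fun measurableSet_Ioi fun k hk => ?_
  have hk0 : (0:ℝ) < k := hk
  have hl := Real.rpow_pos_of_pos hk0 (2*β)
  rw [Real.mul_rpow hc.le hk0.le, Real.mul_rpow hc.le hk0.le, hcT, inv_mul_cancel_left₀ hc.ne']
  have e2 : c ^ (4*β + 2*α - 1) * c ^ (1 - 2*α - 4*β) = 1 := by
    rw [← Real.rpow_add hc, ← Real.rpow_zero c]; congr 1; ring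
  have e3 : k ^ (1 - 2*α) = (k ^ (2*β))^2 * k ^ (1 - 2*α - 4*β) := by
    rw [← Real.rpow_natCast, ← Real.rpow_mul hk0.le, ← Real.rpow_add hk0]
    congr 1; push_cast; ring
  rw [e3, show -(k ^ (2*β)) * T = -(T * k ^ (2*β)) by ring]
  have : ∀ E l K A c1 c2 : ℝ, l ≠ 0 → c1 * c2 = 1 → 
      (E - 1 + l * T) / l ^ 2 * (A * (l^2 * K)) =
      c1 * ((E - 1 + T * l) * (c2 * K) * A) := by
    intro E l K A c1 c2 hl h
    have : c1 * ((E - 1 + T * l) * (c2 * K) * A) = (c1 * c2) * ((E - 1 + T * l) * K * A) := by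
      ring
    rw [this, h]; field_simp
  exact this _ _ _ _ _ _ hl.ne' e2

theorem stmt_0 (α β δ H : ℝ) (hα : α < 1) (hβ : 0 < β) (hαβ : 1 < α + β)
    (hδ : δ = β / (α + 2*β - 1)) (hH : H = 1/2 + (α + β - 1) / (2*β))
    (a : ℝ → ℝ) (ha_cont : Continuous a) (ha_supp : HasCompactSupport a)
    (ha_nonneg : ∀ x, 0 ≤ a x)
    (r : ℝ → ℝ)
    (hr : ∀ s : ℝ, 0 ≤ s →
      r s = ∫ k in Set.Ioi (0:ℝ), Real.exp (-(k ^ (2*β)) * s) * a k * k ^ (1 - 2*α))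
    (t : ℝ) (ht : 0 < t) :
    Tendsto
      (fun ε : ℝ => ε^2 * ∫ s in (0:ℝ)..(t / ε ^ (2*δ)), ∫ s' in (0:ℝ)..s, r s')
      (nhdsWithin 0 (Set.Ioi 0))
      (nhds (a 0 * t ^ (2*H) *
        ∫ k in Set.Ioi (0:ℝ),
          (Real.exp (-(k ^ (2*β))) - 1 + k ^ (2*β)) * k ^ (1 - 2*α - 4*β))) := by
  have hd : 0 < α + 2*β - 1 := by linarith
  have hδ0 : 0 < δ := by rw [hδ]; positivity
  -- the inverse scale
  have hw : Tendsto (fun ε : ℝ => ε ^ (δ/β) * t ^ (-(1/(2*β)))) (nhdsWithin 0 (Set.Ioi 0))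
      (nhds 0) := by
    have h : Tendsto (fun ε : ℝ => ε ^ (δ/β) * t ^ (-(1/(2*β)))) (nhds 0)
        (nhds ((0:ℝ) ^ (δ/β) * t ^ (-(1/(2*β))))) :=
      ((Real.continuousAt_rpow_const 0 (δ/β) (Or.inr (by positivity))).tendsto).mul_const _
    rw [Real.zero_rpow (by positivity), zero_mul] at h
    exact h.mono_left nhdsWithin_le_nhds
  obtain ⟨C, hC⟩ := ha_supp.exists_bound_of_continuous ha_cont
  have hphi := aux_phi α β hα hβ hαβ
  have hlim : Tendsto (fun w : ℝ => ∫ u in Set.Ioi (0:ℝ),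
      (Real.exp (-(u ^ (2*β))) - 1 + u ^ (2*β)) * u ^ (1 - 2*α - 4*β) * a (w * u))
      (nhds 0) (nhds (∫ u in Set.Ioi (0:ℝ),
      (Real.exp (-(u ^ (2*β))) - 1 + u ^ (2*β)) * u ^ (1 - 2*α - 4*β) * a 0)) := by
    refine tendsto_integral_filter_of_dominated_convergence
      (fun u => ‖(Real.exp (-(u ^ (2*β))) - 1 + u ^ (2*β)) * u ^ (1 - 2*α - 4*β)‖ * C)
      ?_ ?_ (hphi.norm.mul_const C) ?_
    · refine Eventually.of_forall fun w => ?_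
      exact hphi.aestronglyMeasurable.mul
        (by fun_prop : Continuous fun u => a (w * u)).aestronglyMeasurable
    · refine Eventually.of_forall fun w => Eventually.of_forall fun u => ?_
      rw [norm_mul]
      exact mul_le_mul_of_nonneg_left (hC _) (norm_nonneg _)
    · refine Eventually.of_forall fun u => ?_
      have : Tendsto (fun w : ℝ => a (w * u)) (nhds 0) (nhds (a (0 * u))) :=
        (by fun_prop : Continuous fun w => a (w * u)).tendsto 0
      rw [zero_mul] at this
      exact this.const_mul _
  have hfin := (hlim.comp hw).const_mul (t ^ (2*H))
  rw [integral_mul_const] at hfin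
  rw [show ∀ I : ℝ, a 0 * t ^ (2*H) * I = t ^ (2*H) * (I * a 0) by intro I; ring]
  refine hfin.congr' ?_
  filter_upwards [self_mem_nhdsWithin] with ε hε
  have hε0 : (0:ℝ) < ε := hε
  have hw0 : 0 < ε ^ (δ/β) * t ^ (-(1/(2*β))) := by positivity
  have hT : 0 < t / ε ^ (2*δ) := by positivity
  rw [aux_F α β hα hβ a ha_cont ha_supp r hr _ hT,
    aux_G α β hβ a (ε ^ (δ/β) * t ^ (-(1/(2*β))))⁻¹ _ (inv_pos.2 hw0), inv_inv, ← mul_assoc]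
  · simp only [Function.comp]
    congr 1
    rw [Real.inv_rpow hw0.le, ← Real.rpow_neg hw0.le,
      Real.mul_rpow (by positivity) (by positivity), ← Real.rpow_mul hε0.le,
      ← Real.rpow_mul ht.le, ← mul_assoc, ← Real.rpow_natCast, ← Real.rpow_add hε0]
    have e1 : ((2:ℕ):ℝ) + δ/β * -(4*β + 2*α - 2) = 0 := by
      rw [hδ]; push_cast; field_simp; ring
    have e2 : -(1/(2*β)) * -(4*β + 2*α - 2) = 2 * H := by
      rw [hH]; field_simp; ring
    rw [e1, e2, Real.rpow_zero, one_mul]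
  · rw [Real.inv_rpow hw0.le, ← Real.rpow_neg hw0.le,
      Real.mul_rpow (by positivity) (by positivity), ← Real.rpow_mul hε0.le,
      ← Real.rpow_mul ht.le]
    have e1 : δ/β * -(2*β) = -(2*δ) := by field_simp
    have e2 : -(1/(2*β)) * -(2*β) = 1 := by field_simp
    rw [e1, e2, Real.rpow_one, Real.rpow_neg hε0.le]
    field_simp
end

section
/- Let d ≥ 2, let α < 1, β > 0 with α + β > 1, let δ = β/(α+2β-1) and H = 1/2 + (α+β-1)/(2β), and let a : [0,∞) → [0,∞) be continuous, compactly supported and nonnegative. For i, j ∈ {1,…,d} and s ≥ 0 define R_{ij}(s) = ∫_{ℝ^d} e^{-|k|^{2β} s} (a(|k|)/|k|^{2α+d-2}) (δ_{ij} − k_i k_j/|k|²) dk, and define D_{ij} = a(0) ∫_{ℝ^d} (e^{-|k|^{2β}} − 1 + |k|^{2β}) |k|^{-(2α+4β+d-2)} (δ_{ij} − k_i k_j/|k|²) dk. Then for every t > 0, lim_{ε → 0⁺} ε² ∫₀^{t/ε^{2δ}} ∫₀^{s} R_{ij}(s') ds' ds = D_{ij} · t^{2H}. -/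
open MeasureTheory Real Filter

/-- The majorant profile. -/
noncomputable def majM (p q r : ℝ) : ℝ := if r ≤ 1 then r ^ p else r ^ q

lemma majM_integrable (d : ℕ) (hd : 2 ≤ d) (p q : ℝ) (hp : -(d:ℝ) < p) (hq : q < -(d:ℝ)) :
    Integrable (fun k : EuclideanSpace ℝ (Fin d) => majM p q ‖k‖) := by
  have : Nontrivial (EuclideanSpace ℝ (Fin d)) := by
    have : Nonempty (Fin d) := ⟨⟨0, by omega⟩⟩
    infer_instance
  have h1 : ((d - 1 : ℕ) : ℝ) = (d:ℝ) - 1 := by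
    rw [Nat.cast_sub (by omega)]; simp
  rw [integrable_fun_norm_addHaar volume (f := majM p q)]
  rw [finrank_euclideanSpace_fin, ← Set.Ioc_union_Ioi_eq_Ioi (zero_le_one (α := ℝ))]
  refine IntegrableOn.union ?_ ?_
  · have h := (intervalIntegral.intervalIntegrable_rpow' (a := 0) (b := 1)
      (r := (d:ℝ) - 1 + p) (by linarith))
    rw [intervalIntegrable_iff_integrableOn_Ioc_of_le zero_le_one] at h
    refine h.congr_fun ?_ measurableSet_Ioc
    intro x hx
    simp only [majM, if_pos hx.2, smul_eq_mul]
    rw [rpow_add hx.1, ← h1, rpow_natCast]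
  · have h := (integrableOn_Ioi_rpow_of_lt (a := (d:ℝ) - 1 + q) (c := 1) (by linarith) one_pos)
    refine h.congr_fun ?_ measurableSet_Ioi
    intro x hx
    have hx' : (1:ℝ) < x := hx
    simp only [majM, if_neg (not_le.2 hx'), smul_eq_mul]
    rw [rpow_add (by linarith), ← h1, rpow_natCast]

/-- The incompressibility projector entry. -/
noncomputable def projP {d : ℕ} (i j : Fin d) (k : EuclideanSpace ℝ (Fin d)) : ℝ :=
  (if i = j then (1:ℝ) else 0) - k i * k j / ‖k‖^2

lemma projP_meas {d : ℕ} (i j : Fin d) : Measurable (projP i j) := by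
  unfold projP
  fun_prop

lemma projP_bound {d : ℕ} (i j : Fin d) (k : EuclideanSpace ℝ (Fin d)) : |projP i j k| ≤ 2 := by
  unfold projP
  have h1 : |(if i = j then (1:ℝ) else 0)| ≤ 1 := by split_ifs <;> simp
  have h2 : |k i * k j / ‖k‖^2| ≤ 1 := by
    rw [abs_div, abs_mul, abs_of_nonneg (sq_nonneg ‖k‖)]
    apply div_le_one_of_le₀ _ (sq_nonneg _)
    have hi := PiLp.norm_apply_le k i
    have hj := PiLp.norm_apply_le k j
    rw [Real.norm_eq_abs] at hi hj
    rw [sq]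
    exact mul_le_mul hi hj (abs_nonneg _) (norm_nonneg _)
  rw [abs_le] at *
  constructor <;> linarith [h1.1, h1.2, h2.1, h2.2]

lemma projP_smul {d : ℕ} (i j : Fin d) (r : ℝ) (hr : 0 < r) (k : EuclideanSpace ℝ (Fin d)) :
    projP i j (r • k) = projP i j k := by
  unfold projP
  congr 1
  rw [norm_smul, Real.norm_of_nonneg hr.le, PiLp.smul_apply, PiLp.smul_apply, smul_eq_mul,
    smul_eq_mul, mul_pow, show r * k i * (r * k j) = r^2 * (k i * k j) by ring]
  exact mul_div_mul_left _ _ (by positivity)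

lemma phi_bound {x : ℝ} (hx : 0 ≤ x) :
    |Real.exp (-x) - 1 + x| ≤ x ∧ |Real.exp (-x) - 1 + x| ≤ x ^ 2 := by
  have h0 := Real.one_sub_le_exp_neg x
  have h1 : Real.exp (-x) ≤ 1 := Real.exp_le_one_iff.2 (by linarith)
  rw [abs_of_nonneg (by linarith)]
  refine ⟨by linarith, ?_⟩
  have h2 : (1 + x) * Real.exp (-x) ≤ 1 := by
    have h3 := Real.add_one_le_exp x
    have h4 : Real.exp x * Real.exp (-x) = 1 := by rw [← Real.exp_add]; simp
    nlinarith [Real.exp_pos (-x)]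
  have h5 : 0 ≤ x * (Real.exp (-x) - 1 + x) := mul_nonneg hx (by linarith)
  nlinarith

lemma a_bound (a : ℝ → ℝ) (ha_cont : Continuous a) (ha_supp : HasCompactSupport a) (b : ℝ)
    (hb : 0 ≤ b) : ∃ C, 0 ≤ C ∧ ∀ r, 0 ≤ r → |a r| ≤ C ∧ |a r| * r ^ b ≤ C := by
  have hc : Continuous (fun r => a r * (1 + |r|) ^ b) := by
    refine ha_cont.mul (Continuous.rpow_const (by fun_prop) ?_)
    intro x; right; exact hb
  obtain ⟨C, hC⟩ := (ha_supp.mul_right (f' := fun r => (1 + |r|) ^ b)).exists_bound_of_continuous hc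
  refine ⟨C, le_trans (norm_nonneg _) (hC 0), fun r hr => ?_⟩
  have h := hC r
  simp only [Pi.mul_apply] at h
  rw [norm_mul, Real.norm_eq_abs, Real.norm_of_nonneg (by positivity), abs_of_nonneg hr] at h
  have h1 : 1 ≤ (1 + r) ^ b := one_le_rpow (by linarith) hb
  have h2 : r ^ b ≤ (1 + r) ^ b := rpow_le_rpow hr (by linarith) hb
  constructor
  · nlinarith [abs_nonneg (a r)]
  · nlinarith [abs_nonneg (a r)]

lemma swap_aux {d : ℕ} (g : EuclideanSpace ℝ (Fin d) → ℝ) (hg : Integrable g)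
    (f : ℝ → EuclideanSpace ℝ (Fin d) → ℝ) (hf : Measurable (Function.uncurry f)) (T C : ℝ)
    (hT : 0 ≤ T) (hb : ∀ s, 0 < s → s ≤ T → ∀ k, |f s k| ≤ C) :
    ∫ s in (0:ℝ)..T, ∫ k, f s k * g k = ∫ k, (∫ s in (0:ℝ)..T, f s k) * g k := by
  simp_rw [intervalIntegral.integral_of_le hT]
  rw [integral_integral_swap]
  · congr 1
    ext k
    rw [integral_mul_const]
  · have h1 := hg.comp_snd (volume.restrict (Set.Ioc 0 T))
    refine h1.bdd_mul (f := Function.uncurry f) (c := C) hf.aestronglyMeasurable ?_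
    have : ∀ᵐ x ∂((volume.restrict (Set.Ioc 0 T)).prod
        (volume : Measure (EuclideanSpace ℝ (Fin d)))), x.1 ∈ Set.Ioc 0 T := by
      have := ae_restrict_mem (μ := volume) (measurableSet_Ioc (a := (0:ℝ)) (b := T))
      exact Measure.quasiMeasurePreserving_fst.ae this
    filter_upwards [this] with x hx
    exact hb x.1 hx.1 hx.2 x.2

lemma int_exp {l : ℝ} (hl : l ≠ 0) (s : ℝ) :
    ∫ x in (0:ℝ)..s, Real.exp (-l * x) = (1 - Real.exp (-l * s)) / l := by
  rw [intervalIntegral.integral_eq_sub_of_hasDerivAt (f := fun x => -Real.exp (-l * x) / l)]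
  · simp; ring
  · intro x _
    have h : HasDerivAt (fun x => -l * x) (-l) x := by
      simpa using (hasDerivAt_id x).const_mul (-l)
    refine (h.exp.neg.div_const l).congr_deriv ?_
    field_simp
  · exact Continuous.intervalIntegrable (by fun_prop) _ _

lemma int_exp2 {l : ℝ} (hl : l ≠ 0) (s : ℝ) :
    ∫ x in (0:ℝ)..s, (1 - Real.exp (-l * x)) / l =
      (Real.exp (-l * s) - 1 + l * s) / l ^ 2 := by
  rw [intervalIntegral.integral_div, intervalIntegral.integral_sub (by simp)
    (Continuous.intervalIntegrable (by fun_prop) _ _), int_exp hl]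
  simp
  field_simp
  ring

lemma fubini_main {d : ℕ} (hd : 2 ≤ d) (g : EuclideanSpace ℝ (Fin d) → ℝ) (hg : Integrable g)
    (β : ℝ) (R : ℝ → ℝ)
    (hR : ∀ s, 0 ≤ s → R s = ∫ k, Real.exp (-(‖k‖ ^ (2*β)) * s) * g k) (T : ℝ) (hT : 0 ≤ T) :
    ∫ s in (0:ℝ)..T, ∫ s' in (0:ℝ)..s, R s' =
      ∫ k, (Real.exp (-(‖k‖ ^ (2*β)) * T) - 1 + ‖k‖ ^ (2*β) * T) / (‖k‖ ^ (2*β)) ^ 2 * g k := by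
  have : Nonempty (Fin d) := ⟨⟨0, by omega⟩⟩
  have : Nontrivial (EuclideanSpace ℝ (Fin d)) := inferInstance
  have hne : ∀ᵐ k : EuclideanSpace ℝ (Fin d), k ≠ 0 := by
    simp [ae_iff]
  have hl : ∀ k : EuclideanSpace ℝ (Fin d), k ≠ 0 → 0 < ‖k‖ ^ (2*β) := fun k hk =>
    rpow_pos_of_pos (norm_pos_iff.2 hk) _
  have h1 : ∀ s, 0 ≤ s → ∫ s' in (0:ℝ)..s, R s' =
      ∫ k, ((1 - Real.exp (-(‖k‖ ^ (2*β)) * s)) / ‖k‖ ^ (2*β)) * g k := by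
    intro s hs
    rw [intervalIntegral.integral_congr (g := fun s' => ∫ k, Real.exp (-(‖k‖ ^ (2*β)) * s') * g k)]
    · rw [swap_aux g hg (fun s' k => Real.exp (-(‖k‖ ^ (2*β)) * s')) _ s 1 hs]
      · refine integral_congr_ae ?_
        filter_upwards [hne] with k hk
        rw [int_exp (hl k hk).ne']
      · intro s' hs' _ k
        rw [abs_of_nonneg (Real.exp_pos _).le, Real.exp_le_one_iff]
        have : 0 ≤ ‖k‖ ^ (2*β) := rpow_nonneg (norm_nonneg _) _
        nlinarith
      · unfold Function.uncurry; fun_prop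
    · intro s' hs'
      rw [Set.uIcc_of_le hs] at hs'
      exact hR s' hs'.1
  rw [intervalIntegral.integral_congr (g := fun s => ∫ k,
    ((1 - Real.exp (-(‖k‖ ^ (2*β)) * s)) / ‖k‖ ^ (2*β)) * g k)]
  · rw [swap_aux g hg (fun s k => (1 - Real.exp (-(‖k‖ ^ (2*β)) * s)) / ‖k‖ ^ (2*β)) _ T T hT]
    · refine integral_congr_ae ?_
      filter_upwards [hne] with k hk
      rw [int_exp2 (hl k hk).ne']
    · intro s hs hsT k
      have h0 : 0 ≤ ‖k‖ ^ (2*β) := rpow_nonneg (norm_nonneg _) _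
      rcases h0.eq_or_lt with h | h
      · rw [← h]; simpa using hT
      · have h3 := Real.one_sub_le_exp_neg (‖k‖ ^ (2*β) * s)
        have h4 : Real.exp (-(‖k‖ ^ (2*β) * s)) ≤ 1 := Real.exp_le_one_iff.2 (by nlinarith)
        rw [neg_mul, abs_of_nonneg (div_nonneg (by linarith) h0), div_le_iff₀ h]
        nlinarith
    · unfold Function.uncurry; fun_prop
  · intro s hs
    rw [Set.uIcc_of_le hT] at hs
    exact h1 s hs.1

/-- The kernel appearing in the limiting matrix. -/
noncomputable def kerK {d : ℕ} (α β : ℝ) (k : EuclideanSpace ℝ (Fin d)) : ℝ :=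
  (Real.exp (-(‖k‖ ^ (2*β))) - 1 + ‖k‖ ^ (2*β)) * ‖k‖ ^ (-(2*α + 4*β + (d:ℝ) - 2))

lemma kerK_meas {d : ℕ} (α β : ℝ) : Measurable (kerK (d := d) α β) := by
  unfold kerK; fun_prop

lemma kerK_bound {d : ℕ} (α β : ℝ) (k : EuclideanSpace ℝ (Fin d)) (hk : k ≠ 0) :
    |kerK α β k| ≤ majM (-(2*α + (d:ℝ) - 2)) (-(2*α + 2*β + (d:ℝ) - 2)) ‖k‖ := by
  have hn : 0 < ‖k‖ := norm_pos_iff.2 hk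
  have h0 : 0 ≤ ‖k‖ ^ (2*β) := rpow_nonneg (norm_nonneg _) _
  obtain ⟨h1, h2⟩ := phi_bound h0
  unfold kerK majM
  rw [abs_mul, abs_of_nonneg (rpow_nonneg hn.le (-(2*α + 4*β + (d:ℝ) - 2)))]
  have hp : 0 ≤ ‖k‖ ^ (-(2*α + 4*β + (d:ℝ) - 2)) := rpow_nonneg hn.le _
  split_ifs
  · refine (mul_le_mul_of_nonneg_right h2 hp).trans (le_of_eq ?_)
    rw [← rpow_natCast, ← rpow_mul hn.le, ← rpow_add hn]
    congr 1; push_cast; ring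
  · refine (mul_le_mul_of_nonneg_right h1 hp).trans (le_of_eq ?_)
    rw [← rpow_add hn]
    congr 1; ring

lemma g_integrable {d : ℕ} (hd : 2 ≤ d) (α β : ℝ) (hα : α < 1) (hβ : 0 < β)
    (hαβ : 1 < α + β) (a : ℝ → ℝ) (ha_cont : Continuous a) (ha_supp : HasCompactSupport a)
    (i j : Fin d) :
    Integrable (fun k : EuclideanSpace ℝ (Fin d) =>
      a ‖k‖ / ‖k‖ ^ (2*α + (d:ℝ) - 2) * projP i j k) := by
  have : Nonempty (Fin d) := ⟨⟨0, by omega⟩⟩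
  have : Nontrivial (EuclideanSpace ℝ (Fin d)) := inferInstance
  have hne : ∀ᵐ k : EuclideanSpace ℝ (Fin d), k ≠ 0 := by
    simp [ae_iff]
  obtain ⟨C, hC0, hC⟩ := a_bound a ha_cont ha_supp (2*β) (by linarith)
  have hM := (majM_integrable d hd (-(2*α + (d:ℝ) - 2)) (-(2*α + 2*β + (d:ℝ) - 2))
    (by linarith) (by linarith)).const_mul (C * 2)
  refine hM.mono' ?_ ?_
  · have := projP_meas i j
    have := ha_cont.measurable
    exact Measurable.aestronglyMeasurable (by fun_prop)
  · filter_upwards [hne] with k hk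
    have hn : 0 < ‖k‖ := norm_pos_iff.2 hk
    obtain ⟨h1, h2⟩ := hC ‖k‖ hn.le
    rw [norm_mul, Real.norm_eq_abs, Real.norm_eq_abs, div_eq_mul_inv, ← rpow_neg hn.le, abs_mul,
      abs_of_nonneg (rpow_nonneg hn.le (-(2*α + (d:ℝ) - 2)))]
    have h3 : |a ‖k‖| * ‖k‖ ^ (-(2*α + (d:ℝ) - 2)) ≤
        C * majM (-(2*α + (d:ℝ) - 2)) (-(2*α + 2*β + (d:ℝ) - 2)) ‖k‖ := by
      unfold majM
      split_ifs
      · exact mul_le_mul_of_nonneg_right h1 (rpow_nonneg hn.le _)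
      · refine le_trans (le_of_eq ?_) (mul_le_mul_of_nonneg_right h2 (rpow_nonneg hn.le _))
        rw [mul_assoc, ← rpow_add hn]
        congr 2; ring
    have h4 := mul_le_mul h3 (projP_bound i j k) (abs_nonneg _)
      ((mul_nonneg (abs_nonneg _) (rpow_nonneg hn.le _)).trans h3)
    linarith

lemma scaling_main {d : ℕ} (hd : 2 ≤ d) (α β : ℝ) (hβ : 0 < β) (a : ℝ → ℝ)
    (i j : Fin d) (T : ℝ) (hT : 0 < T) :
    ∫ k : EuclideanSpace ℝ (Fin d),
      (Real.exp (-(‖k‖ ^ (2*β)) * T) - 1 + ‖k‖ ^ (2*β) * T) / (‖k‖ ^ (2*β)) ^ 2 *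
        (a ‖k‖ / ‖k‖ ^ (2*α + (d:ℝ) - 2) * projP i j k) =
    T ^ (2 + (α - 1) / β) * ∫ k : EuclideanSpace ℝ (Fin d),
      a (T ^ (-(1/(2*β))) * ‖k‖) * (kerK α β k * projP i j k) := by
  have : Nonempty (Fin d) := ⟨⟨0, by omega⟩⟩
  have : Nontrivial (EuclideanSpace ℝ (Fin d)) := inferInstance
  have hne : ∀ᵐ k : EuclideanSpace ℝ (Fin d), k ≠ 0 := by
    simp [ae_iff]
  set r := T ^ (-(1/(2*β))) with hr
  have hr0 : 0 < r := rpow_pos_of_pos hT _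
  set f : EuclideanSpace ℝ (Fin d) → ℝ := fun k =>
    (Real.exp (-(‖k‖ ^ (2*β)) * T) - 1 + ‖k‖ ^ (2*β) * T) / (‖k‖ ^ (2*β)) ^ 2 *
        (a ‖k‖ / ‖k‖ ^ (2*α + (d:ℝ) - 2) * projP i j k) with hf
  have h := Measure.integral_comp_smul volume f r
  rw [finrank_euclideanSpace_fin, abs_of_nonneg (by positivity), smul_eq_mul,
    eq_inv_mul_iff_mul_eq₀ (by positivity)] at h
  rw [← h, ← integral_const_mul, ← integral_const_mul]
  refine integral_congr_ae ?_
  filter_upwards [hne] with k hk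
  have hn : 0 < ‖k‖ := norm_pos_iff.2 hk
  simp only [hf]
  rw [projP_smul i j r hr0, norm_smul, Real.norm_of_nonneg hr0.le]
  have e1 : (r * ‖k‖) ^ (2*β) = T⁻¹ * ‖k‖ ^ (2*β) := by
    rw [mul_rpow hr0.le hn.le, hr, ← rpow_mul hT.le, ← rpow_neg_one]
    congr 2; field_simp
  have e2 : (r * ‖k‖) ^ (2*α + (d:ℝ) - 2) =
      T ^ (-(1/(2*β)) * (2*α + (d:ℝ) - 2)) * ‖k‖ ^ (2*α + (d:ℝ) - 2) := by
    rw [mul_rpow hr0.le hn.le, hr, ← rpow_mul hT.le]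
  have e3 : r ^ d = T ^ (-(1/(2*β)) * d) := by
    rw [hr, ← rpow_natCast, ← rpow_mul hT.le]
  have e4 : T ^ (2 + (α - 1) / β) = T ^ 2 * T ^ (-(1/(2*β)) * d) /
      T ^ (-(1/(2*β)) * (2*α + (d:ℝ) - 2)) := by
    rw [← rpow_natCast, ← rpow_add hT, ← rpow_sub hT]
    congr 1; field_simp; push_cast; ring
  have e5 : ‖k‖ ^ (-(2*α + 4*β + (d:ℝ) - 2)) =
      ((‖k‖ ^ (2*β)) ^ 2 * ‖k‖ ^ (2*α + (d:ℝ) - 2))⁻¹ := by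
    rw [rpow_neg hn.le, ← rpow_natCast, ← rpow_mul hn.le, ← rpow_add hn]
    congr 2; push_cast; ring
  rw [e1, e2, e3, e4, kerK, e5]
  have e6 : -(T⁻¹ * ‖k‖ ^ (2*β)) * T = -(‖k‖ ^ (2*β)) := by field_simp
  have e7 : T⁻¹ * ‖k‖ ^ (2*β) * T = ‖k‖ ^ (2*β) := by field_simp
  rw [e6, e7]
  have p1 : 0 < ‖k‖ ^ (2*β) := rpow_pos_of_pos hn _
  have p2 : 0 < ‖k‖ ^ (2*α + (d:ℝ) - 2) := rpow_pos_of_pos hn _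
  have p3 : 0 < T ^ (-(1/(2*β)) * (2*α + (d:ℝ) - 2)) := rpow_pos_of_pos hT _
  generalize T ^ (-(1/(2*β)) * (2*α + (d:ℝ) - 2)) = A at *
  generalize T ^ (-(1/(2*β)) * (d:ℝ)) = B at *
  generalize ‖k‖ ^ (2*α + (d:ℝ) - 2) = A' at *
  generalize ‖k‖ ^ (2*β) = B' at *
  generalize a (r * ‖k‖) = a' at *
  generalize projP i j k = P at *
  generalize Real.exp (-B') - 1 + B' = Q at *
  field_simp

lemma dct_main {d : ℕ} (hd : 2 ≤ d) (α β : ℝ) (hα : α < 1) (hβ : 0 < β)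
    (hαβ : 1 < α + β) (a : ℝ → ℝ) (ha_cont : Continuous a) (ha_supp : HasCompactSupport a)
    (i j : Fin d) :
    Tendsto (fun r : ℝ => ∫ k : EuclideanSpace ℝ (Fin d),
      a (r * ‖k‖) * (kerK α β k * projP i j k)) (nhds 0)
      (nhds (a 0 * ∫ k : EuclideanSpace ℝ (Fin d), kerK α β k * projP i j k)) := by
  have : Nonempty (Fin d) := ⟨⟨0, by omega⟩⟩
  have : Nontrivial (EuclideanSpace ℝ (Fin d)) := inferInstance
  have hne : ∀ᵐ k : EuclideanSpace ℝ (Fin d), k ≠ 0 := by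
    simp [ae_iff]
  obtain ⟨C, hC⟩ := ha_supp.exists_bound_of_continuous ha_cont
  have hC0 : 0 ≤ C := (norm_nonneg _).trans (hC 0)
  have hM := (majM_integrable d hd (-(2*α + (d:ℝ) - 2)) (-(2*α + 2*β + (d:ℝ) - 2))
    (by linarith) (by linarith)).const_mul (C * 2)
  rw [← integral_const_mul]
  refine tendsto_integral_filter_of_dominated_convergence _ ?_ ?_ hM ?_
  · refine Eventually.of_forall fun r => ?_
    have := projP_meas i j
    have := ha_cont.measurable
    have := kerK_meas (d := d) α β
    exact Measurable.aestronglyMeasurable (by fun_prop)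
  · refine Eventually.of_forall fun r => ?_
    filter_upwards [hne] with k hk
    have h1 := kerK_bound α β k hk
    have h2 := projP_bound i j k
    have h3 := mul_le_mul h1 h2 (abs_nonneg _) ((abs_nonneg _).trans h1)
    rw [← abs_mul] at h3
    have h4 := mul_le_mul (hC (r * ‖k‖)) h3 (abs_nonneg _) hC0
    rw [norm_mul, Real.norm_eq_abs (kerK α β k * _)]
    linarith
  · refine Eventually.of_forall fun k => ?_
    refine Tendsto.mul_const _ ?_
    have : Continuous fun r : ℝ => a (r * ‖k‖) := by fun_prop
    simpa using this.tendsto 0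

theorem stmt_1 (d : ℕ) (hd : 2 ≤ d) (α β δ H : ℝ) (hα : α < 1) (hβ : 0 < β)
    (hαβ : 1 < α + β)
    (hδ : δ = β / (α + 2*β - 1)) (hH : H = 1/2 + (α + β - 1) / (2*β))
    (a : ℝ → ℝ) (ha_cont : Continuous a) (ha_supp : HasCompactSupport a)
    (ha_nonneg : ∀ x, 0 ≤ a x)
    (R : Fin d → Fin d → ℝ → ℝ)
    (hR : ∀ (i j : Fin d) (s : ℝ), 0 ≤ s → R i j s =
      ∫ k : EuclideanSpace ℝ (Fin d),
        Real.exp (-(‖k‖ ^ (2*β)) * s) * (a ‖k‖ / ‖k‖ ^ (2*α + (d:ℝ) - 2)) *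
          ((if i = j then (1:ℝ) else 0) - k i * k j / ‖k‖^2))
    (D : Fin d → Fin d → ℝ)
    (hD : ∀ i j : Fin d, D i j = a 0 *
      ∫ k : EuclideanSpace ℝ (Fin d),
        (Real.exp (-(‖k‖ ^ (2*β))) - 1 + ‖k‖ ^ (2*β)) *
          ‖k‖ ^ (-(2*α + 4*β + (d:ℝ) - 2)) *
          ((if i = j then (1:ℝ) else 0) - k i * k j / ‖k‖^2))
    (i j : Fin d) (t : ℝ) (ht : 0 < t) :
    Tendsto
      (fun ε : ℝ => ε^2 * ∫ s in (0:ℝ)..(t / ε ^ (2*δ)), ∫ s' in (0:ℝ)..s, R i j s')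
      (nhdsWithin 0 (Set.Ioi 0))
      (nhds (D i j * t ^ (2*H))) := by
  have hc : 0 < α + 2*β - 1 := by linarith
  have hδ0 : 0 < δ := by rw [hδ]; positivity
  have h2H : 2 * H = 2 + (α - 1) / β := by rw [hH]; field_simp; ring
  have h1 : 2 * δ * (2 * H) = 2 := by rw [h2H, hδ]; field_simp; ring
  have hRR : ∀ s, 0 ≤ s → R i j s = ∫ k : EuclideanSpace ℝ (Fin d),
      Real.exp (-(‖k‖ ^ (2*β)) * s) * (a ‖k‖ / ‖k‖ ^ (2*α + (d:ℝ) - 2) * projP i j k) := by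
    intro s hs
    rw [hR i j s hs]
    simp only [projP, mul_assoc]
  have hg := g_integrable hd α β hα hβ hαβ a ha_cont ha_supp i j
  have hDD : D i j = a 0 * ∫ k : EuclideanSpace ℝ (Fin d), kerK α β k * projP i j k := hD i j
  have key : ∀ ε ∈ Set.Ioi (0:ℝ), t ^ (2*H) * ∫ k : EuclideanSpace ℝ (Fin d),
      a ((t / ε ^ (2*δ)) ^ (-(1/(2*β))) * ‖k‖) * (kerK α β k * projP i j k) =
      ε^2 * ∫ s in (0:ℝ)..(t / ε ^ (2*δ)), ∫ s' in (0:ℝ)..s, R i j s' := by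
    intro ε hε
    have hε : 0 < ε := hε
    have hp : 0 < ε ^ (2*δ) := rpow_pos_of_pos hε _
    have hT : 0 < t / ε ^ (2*δ) := div_pos ht hp
    rw [fubini_main hd _ hg β (R i j) hRR _ hT.le, scaling_main hd α β hβ a i j _ hT, ← h2H,
      ← mul_assoc]
    congr 1
    rw [div_rpow ht.le hp.le, ← rpow_mul hε.le, h1, rpow_two]
    field_simp
  rw [hDD, mul_comm _ (t ^ (2*H))]
  refine Tendsto.congr' (eventually_nhdsWithin_of_forall key) ?_
  refine Tendsto.const_mul _ ?_
  refine (dct_main hd α β hα hβ hαβ a ha_cont ha_supp i j).comp ?_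
  have hinf : Tendsto (fun ε : ℝ => t / ε ^ (2*δ)) (nhdsWithin 0 (Set.Ioi 0)) atTop := by
    have hz : Tendsto (fun ε : ℝ => ε ^ (2*δ)) (nhdsWithin 0 (Set.Ioi 0))
        (nhdsWithin 0 (Set.Ioi 0)) := by
      refine tendsto_nhdsWithin_iff.2 ⟨?_, ?_⟩
      · have := (continuous_rpow_const (q := 2*δ) (by linarith)).tendsto 0
        rw [zero_rpow (by linarith)] at this
        exact this.mono_left nhdsWithin_le_nhds
      · exact eventually_nhdsWithin_of_forall fun ε hε => rpow_pos_of_pos hε _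
    exact (tendsto_inv_nhdsGT_zero.comp hz).const_mul_atTop ht
  exact (tendsto_rpow_neg_atTop (by positivity)).comp hinf
end

section
/- Let α < 1 and β > 0 be real numbers with α + β > 1. Then the function k ↦ (e^{-k^{2β}} − 1 + k^{2β}) k^{1−2α−4β} is integrable on (0, ∞). -/
open MeasureTheory Real

theorem stmt_3 (α β : ℝ) (hα : α < 1) (hβ : 0 < β) (hαβ : 1 < α + β) :
    IntegrableOn
      (fun k : ℝ => (Real.exp (-(k ^ (2*β))) - 1 + k ^ (2*β)) * k ^ (1 - 2*α - 4*β))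
      (Set.Ioi 0) := by
  have hm : Measurable
      (fun k : ℝ => (Real.exp (-(k ^ (2*β))) - 1 + k ^ (2*β)) * k ^ (1 - 2*α - 4*β)) := by
    fun_prop
  rw [← Set.Ioc_union_Ioi_eq_Ioi (zero_le_one' ℝ)]
  refine IntegrableOn.union ?_ ?_
  · have h1 : IntegrableOn (fun k : ℝ => k ^ (1 - 2*α)) (Set.Ioc 0 1) := by
      rw [← intervalIntegrable_iff_integrableOn_Ioc_of_le zero_le_one]
      exact intervalIntegral.intervalIntegrable_rpow' (by linarith)
    refine Integrable.mono' h1 hm.aestronglyMeasurable ?_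
    filter_upwards [ae_restrict_mem measurableSet_Ioc] with k hk
    have hk0 : 0 < k := hk.1
    have hx0 : 0 ≤ k ^ (2*β) := rpow_nonneg hk0.le _
    have hx1 : k ^ (2*β) ≤ 1 := rpow_le_one hk0.le hk.2 (by linarith)
    have h2 := Real.abs_exp_sub_one_sub_id_le (x := -(k ^ (2*β)))
      (by rw [abs_neg, abs_of_nonneg hx0]; exact hx1)
    have h3 : k ^ (1 - 2*α) = (-(k ^ (2*β))) ^ 2 * k ^ (1 - 2*α - 4*β) := by
      rw [neg_sq, sq, ← rpow_add hk0, ← rpow_add hk0]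
      congr 1; ring
    rw [norm_mul, Real.norm_eq_abs, Real.norm_of_nonneg (rpow_nonneg hk0.le _), h3]
    rw [sub_neg_eq_add] at h2
    exact mul_le_mul_of_nonneg_right h2 (rpow_nonneg hk0.le _)
  · have h1 : IntegrableOn (fun k : ℝ => k ^ (1 - 2*α - 2*β)) (Set.Ioi 1) :=
      integrableOn_Ioi_rpow_of_lt (by linarith) one_pos
    refine Integrable.mono' h1 hm.aestronglyMeasurable ?_
    filter_upwards [ae_restrict_mem measurableSet_Ioi] with k hk
    have hk0 : 0 < k := one_pos.trans hk
    have hx0 : 0 ≤ k ^ (2*β) := rpow_nonneg hk0.le _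
    have h3 : k ^ (1 - 2*α - 2*β) = k ^ (2*β) * k ^ (1 - 2*α - 4*β) := by
      rw [← rpow_add hk0]
      congr 1; ring
    have h4 := Real.add_one_le_exp (-(k ^ (2*β)))
    have h5 : Real.exp (-(k ^ (2*β))) ≤ 1 := Real.exp_le_one_iff.2 (by linarith)
    rw [norm_mul, Real.norm_of_nonneg (by linarith),
      Real.norm_of_nonneg (rpow_nonneg hk0.le _), h3]
    exact mul_le_mul_of_nonneg_right (by linarith) (rpow_nonneg hk0.le _)
end

section
/- Let n ≥ 1 be an integer and β ≥ 1/2 a real number. Then there exists a constant C > 0, depending only on n and β, such that for all λ > 0, all nonnegative reals k₁, …, k_n, and every index j ∈ {1, …, n}, (k₁ + ⋯ + k_n)/(λ^{2β} + k₁^{2β} + ⋯ + k_n^{2β}) ≤ C (λ + k_j)/(λ^{2β} + k_j^{2β}). -/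
open Real

theorem stmt_9 (n : ℕ) (hn : 1 ≤ n) (β : ℝ) (hβ : (1:ℝ)/2 ≤ β) :
    ∃ C : ℝ, 0 < C ∧ ∀ l : ℝ, 0 < l → ∀ k : Fin n → ℝ, (∀ i, 0 ≤ k i) →
      ∀ j : Fin n,
        (∑ i, k i) / (l ^ (2*β) + ∑ i, (k i) ^ (2*β)) ≤
          C * (l + k j) / (l ^ (2*β) + (k j) ^ (2*β)) := by
  refine ⟨n, by exact_mod_cast hn, ?_⟩
  intro l hl k hk j
  have hp : (1:ℝ) ≤ 2 * β := by linarith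
  generalize 2 * β = p at hp
  have hlp : 0 < l ^ p := rpow_pos_of_pos hl p
  have hkp : ∀ i, 0 ≤ k i ^ p := fun i => rpow_nonneg (hk i) p
  have hS : ∀ i, k i ^ p ≤ ∑ i, k i ^ p := fun i =>
    Finset.single_le_sum (f := fun i => k i ^ p) (fun i _ => hkp i) (Finset.mem_univ i)
  have hm : 0 < l + k j := by linarith [hk j]
  have split : ∀ x : ℝ, 0 ≤ x → x ^ p = x * x ^ (p - 1) := by
    intro x hx
    have h := rpow_add_of_nonneg hx zero_le_one (sub_nonneg.2 hp)
    rwa [rpow_one, add_sub_cancel] at h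
  have key : ∀ i, k i * (l ^ p + k j ^ p) ≤ (l + k j) * (l ^ p + ∑ i, k i ^ p) := by
    intro i
    rcases le_total (k i) (l + k j) with h | h
    · exact mul_le_mul h (by linarith [hS j]) (by linarith [hkp j]) hm.le
    · have h1 : l ^ (p-1) ≤ k i ^ (p-1) :=
        rpow_le_rpow hl.le (by linarith [hk j]) (by linarith)
      have h2 : k j ^ (p-1) ≤ k i ^ (p-1) :=
        rpow_le_rpow (hk j) (by linarith) (by linarith)
      have h3 : l ^ p + k j ^ p ≤ (l + k j) * k i ^ (p-1) := by
        rw [split l hl.le, split (k j) (hk j), add_mul]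
        exact add_le_add (mul_le_mul_of_nonneg_left h1 hl.le)
          (mul_le_mul_of_nonneg_left h2 (hk j))
      calc k i * (l ^ p + k j ^ p) ≤ k i * ((l + k j) * k i ^ (p-1)) :=
            mul_le_mul_of_nonneg_left h3 (hk i)
        _ = (l + k j) * k i ^ p := by rw [split (k i) (hk i)]; ring
        _ ≤ _ := mul_le_mul_of_nonneg_left (by linarith [hS i]) hm.le
  rw [div_le_div_iff₀ (by linarith [hS j, hkp j]) (by linarith [hkp j]), Finset.sum_mul]
  calc _ ≤ ∑ _i : Fin n, (l + k j) * (l ^ p + ∑ i, k i ^ p) :=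
        Finset.sum_le_sum fun i _ => key i
    _ = _ := by simp [mul_assoc]
end

section
/- Let K > 0, let α < 1 and β > 0 be real numbers, let q ≥ 0 and r ∈ {0, 1}, and suppose e := 2 − 2α + q − 2β(q + r) ≠ 0. Then there exists a constant C > 0 such that for every λ ∈ (0, 1], ∫₀^K (λ + k)^q (λ^{2β} + k^{2β})^{-(q+r)} k^{1-2α} dk ≤ C · max(1, λ^{e}). -/
open MeasureTheory Real

theorem stmt_10 (K α β q r : ℝ) (hK : 0 < K) (hα : α < 1) (hβ : 0 < β)
    (hq : 0 ≤ q) (hr : r = 0 ∨ r = 1)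
    (e : ℝ) (he : e = 2 - 2*α + q - 2*β*(q + r)) (he0 : e ≠ 0) :
    ∃ C : ℝ, 0 < C ∧ ∀ l : ℝ, l ∈ Set.Ioc (0:ℝ) 1 →
      (∫ k in (0:ℝ)..K,
          (l + k) ^ q * (l ^ (2*β) + k ^ (2*β)) ^ (-(q + r)) * k ^ (1 - 2*α)) ≤
        C * max 1 (l ^ e) := by
  have hp : 0 ≤ q + r := by rcases hr with h | h <;> subst h <;> linarith
  have hs : -1 < 1 - 2*α := by linarith
  obtain ⟨M, hM⟩ : ∃ M, M = max K 1 := ⟨_, rfl⟩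
  have hMK : K ≤ M := hM ▸ le_max_left _ _
  have hM1 : 1 ≤ M := hM ▸ le_max_right _ _
  have hM0 : 0 < M := by linarith
  have hMe : 0 < M ^ e := rpow_pos_of_pos hM0 e
  have habs : 0 < |e| := abs_pos.mpr he0
  have h2q : (0:ℝ) < 2 ^ q := rpow_pos_of_pos two_pos q
  have hden : 0 < 2 - 2*α := by linarith
  refine ⟨2 ^ q * (1 / (2 - 2*α) + (M ^ e + 1) / |e|), by positivity, ?_⟩
  rintro l ⟨hl, hl1⟩
  have hle : 0 < l ^ e := rpow_pos_of_pos hl e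
  have hlb : 0 < l ^ (2*β) := rpow_pos_of_pos hl _
  set f : ℝ → ℝ := fun k =>
    (l + k) ^ q * (l ^ (2*β) + k ^ (2*β)) ^ (-(q + r)) * k ^ (1 - 2*α) with hf
  have hfnn : ∀ k, 0 ≤ k → 0 ≤ f k := by
    intro k hk
    have := rpow_nonneg hk (2*β)
    simp only [hf]
    positivity
  have hint : ∀ a b, 0 ≤ a → 0 ≤ b → IntervalIntegrable f volume a b := by
    intro a b ha hb
    refine (intervalIntegral.intervalIntegrable_rpow' hs).continuousOn_mul ?_
    have hnn : ∀ x ∈ Set.uIcc a b, 0 ≤ x := fun x hx => (le_min ha hb).trans hx.1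
    refine ContinuousOn.mul ?_ ?_
    · exact ContinuousOn.rpow_const (by fun_prop) (fun x hx => Or.inr hq)
    · refine ContinuousOn.rpow_const ?_ ?_
      · exact continuousOn_const.add
          (continuousOn_id.rpow_const (fun x hx => Or.inr (by positivity)))
      · intro x hx
        have := rpow_nonneg (hnn x hx) (2*β)
        left; positivity
  have h1 : ∫ k in (0:ℝ)..l, f k ≤ 2 ^ q * (l ^ e / (2 - 2*α)) := by
    have hb : ∫ k in (0:ℝ)..l, f k ≤
        ∫ k in (0:ℝ)..l, (2 ^ q * l ^ (q - 2*β*(q+r))) * k ^ (1 - 2*α) := by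
      refine intervalIntegral.integral_mono_on hl.le (hint _ _ le_rfl hl.le)
        ((intervalIntegral.intervalIntegrable_rpow' hs).const_mul _) ?_
      intro k hk
      have hk0 := hk.1
      have hkb := rpow_nonneg hk0 (2*β)
      have a1 : (l + k) ^ q ≤ 2 ^ q * l ^ q := by
        rw [← mul_rpow two_pos.le hl.le]
        exact rpow_le_rpow (by linarith) (by linarith [hk.2]) hq
      have a2 : (l ^ (2*β) + k ^ (2*β)) ^ (-(q + r)) ≤ l ^ (-(2*β*(q+r))) := by
        rw [show -(2*β*(q+r)) = (2*β) * (-(q+r)) by ring, rpow_mul hl.le (2*β) (-(q+r))]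
        exact Real.rpow_le_rpow_of_nonpos hlb (by linarith) (by linarith)
      have a3 : l ^ (q - 2*β*(q+r)) = l ^ q * l ^ (-(2*β*(q+r))) := by
        rw [← rpow_add hl]; ring_nf
      simp only [hf]
      rw [a3, ← mul_assoc]
      exact mul_le_mul_of_nonneg_right
        (mul_le_mul a1 a2 (by positivity) (by positivity)) (by positivity)
    refine hb.trans (le_of_eq ?_)
    rw [intervalIntegral.integral_const_mul, integral_rpow (Or.inl hs),
      show 1 - 2*α + 1 = 2 - 2*α by ring, zero_rpow hden.ne', sub_zero, mul_assoc,
      ← mul_div_assoc, ← rpow_add hl, he]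
    ring_nf
  have h2 : ∫ k in l..M, f k ≤ 2 ^ q * ((M ^ e - l ^ e) / e) := by
    have hlM : l ≤ M := by linarith
    have h0 : (0:ℝ) ∉ Set.uIcc l M := by
      rw [Set.uIcc_of_le hlM]; intro h; linarith [h.1]
    have hb : ∫ k in l..M, f k ≤ ∫ k in l..M, 2 ^ q * k ^ (e - 1) := by
      refine intervalIntegral.integral_mono_on hlM (hint _ _ hl.le hM0.le)
        ((intervalIntegral.intervalIntegrable_rpow (Or.inr h0)).const_mul _) ?_
      intro k hk
      have hk0 : 0 < k := by linarith [hk.1]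
      have hkb : 0 < k ^ (2*β) := rpow_pos_of_pos hk0 _
      have a1 : (l + k) ^ q ≤ 2 ^ q * k ^ q := by
        rw [← mul_rpow two_pos.le hk0.le]
        exact rpow_le_rpow (by linarith) (by linarith [hk.1]) hq
      have a2 : (l ^ (2*β) + k ^ (2*β)) ^ (-(q + r)) ≤ k ^ (-(2*β*(q+r))) := by
        rw [show -(2*β*(q+r)) = (2*β) * (-(q+r)) by ring, rpow_mul hk0.le (2*β) (-(q+r))]
        exact Real.rpow_le_rpow_of_nonpos hkb (by linarith) (by linarith)
      have a3 : k ^ (e - 1) = k ^ q * k ^ (-(2*β*(q+r))) * k ^ (1 - 2*α) := by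
        rw [← rpow_add hk0, ← rpow_add hk0, he]; ring_nf
      simp only [hf]
      rw [a3, ← mul_assoc, ← mul_assoc]
      exact mul_le_mul_of_nonneg_right
        (mul_le_mul a1 a2 (by positivity) (by positivity)) (by positivity)
    refine hb.trans (le_of_eq ?_)
    rw [intervalIntegral.integral_const_mul,
      integral_rpow (Or.inr ⟨fun h => he0 (by linarith), h0⟩), sub_add_cancel]
  have h3 : ∫ k in (0:ℝ)..K, f k ≤ ∫ k in (0:ℝ)..M, f k := by
    rw [← intervalIntegral.integral_add_adjacent_intervals (hint 0 K le_rfl hK.le)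
      (hint K M hK.le hM0.le)]
    have := intervalIntegral.integral_nonneg (μ := volume) hMK
      (fun k hk => hfnn k (hK.le.trans hk.1))
    linarith
  rw [← intervalIntegral.integral_add_adjacent_intervals (hint 0 l le_rfl hl.le)
      (hint l M hl.le hM0.le)] at h3
  have m1 : 1 ≤ max 1 (l ^ e) := le_max_left _ _
  have m2 : l ^ e ≤ max 1 (l ^ e) := le_max_right _ _
  generalize max 1 (l ^ e) = m at m1 m2
  have h4 : (M ^ e - l ^ e) / e ≤ (M ^ e + 1) / |e| * m := by
    have : (M ^ e - l ^ e) / e ≤ ((M ^ e + 1) * m) / |e| := by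
      rcases lt_or_gt_of_ne he0 with h | h
      · rw [abs_of_neg h, ← neg_div_neg_eq]
        exact div_le_div_of_nonneg_right (by nlinarith) (by linarith)
      · rw [abs_of_pos h]
        exact div_le_div_of_nonneg_right (by nlinarith) (by linarith)
    rwa [div_mul_eq_mul_div]
  have h5 : l ^ e / (2 - 2*α) ≤ 1 / (2 - 2*α) * m := by
    rw [div_mul_eq_mul_div, one_mul]
    exact div_le_div_of_nonneg_right m2 hden.le
  calc _ ≤ _ := h3
    _ ≤ 2 ^ q * (l ^ e / (2 - 2*α)) + 2 ^ q * ((M ^ e - l ^ e) / e) := add_le_add h1 h2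
    _ ≤ 2 ^ q * (1 / (2 - 2*α) * m) + 2 ^ q * ((M ^ e + 1) / |e| * m) := by gcongr
    _ = _ := by ring
end
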